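/- Let z ∈ 𝒜^ℤ be admissible, i.e. z is not periodic under the shift and its orbit 𝒪_z := {τ_k(z) : k∈ℤ} is open in the orbit closure X := cl(𝒪_z). Set X₀ := 𝒪_z and X_∞ := X \ X₀. Let h : X × ℤ → ℂ be continuous with compact support and self-adjoint. For X_∞ ⊆ M ⊆ X with M₀ := M \ X_∞, let H_M be the bounded operator on ℓ²(M₀) given by [H_M(v)](x) = Σ_{−l ∈ ℤ_x(M)} h(τ_{−l}(x), l) v(τ_{−l}(x)), and write H := H_X on ℓ²(X₀). Let (M_i)_{i∈I} be a net of clopen subsets of X such that X_∞ ⊆ M_i, X \ M_i is a finite subset of X₀ for every i, and M_i converges to X_∞ in the Fell topology (equivalently, for every compact K ⊆ X with K ∩ X_∞ = ∅ one eventually has M_i ∩ K = ∅). Then inf sp_ess(H) = sup_{i∈I} [ inf sp(H_{M_i}) ] and sup sp_ess(H) = inf_{i∈I} [ sup sp(H_{M_i}) ]. -/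

import Mathlib

open scoped ENNReal

noncomputable section

/-- The Hilbert space `ℓ²(X)` of square-summable complex functions on `X`. -/
abbrev l2 (X : Type) : Type := lp (fun _ : X => ℂ) 2

/-- The shift action of `ℤ` on `𝒜^ℤ`: `(τ_k x)(n) = x(n - k)`. -/
def tau {𝒜 : Type} (k : ℤ) (x : ℤ → 𝒜) : ℤ → 𝒜 := fun n => x (n - k)

/-- The (real) essential spectrum of a bounded operator: the spectrum of its image in the
Calkin algebra, i.e. `t` belongs to it iff `H - t` is not invertible modulo the closed ideal
of compact operators. -/
def essSpectrum {X : Type} (H : l2 X →L[ℂ] l2 X) : Set ℝ :=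
  {t : ℝ | ¬ ∃ S : l2 X →L[ℂ] l2 X,
      IsCompactOperator ⇑(S * (H - (t : ℂ) • 1) - 1) ∧
      IsCompactOperator ⇑((H - (t : ℂ) • 1) * S - 1)}


open Filter Topology
open scoped InnerProductSpace

section Hilbert
variable {E : Type*} [NormedAddCommGroup E] [InnerProductSpace ℂ E] [CompleteSpace E]

/-- A lower bound for the spectrum of a self-adjoint operator is the same as a lower bound for
its quadratic form. -/
lemma forall_le_spectrum_iff {T : E →L[ℂ] E} (hT : IsSelfAdjoint T) (c : ℝ) :
    (∀ t ∈ spectrum ℝ T, c ≤ t) ↔ ∀ v : E, c * ‖v‖ ^ 2 ≤ (⟪T v, v⟫_ℂ).re := by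
  rw [← algebraMap_le_iff_le_spectrum hT, ContinuousLinearMap.le_def]
  have hc : IsSelfAdjoint (algebraMap ℝ (E →L[ℂ] E) c) := .algebraMap _ (.all _)
  have key (v : E) : (⟪(T - algebraMap ℝ (E →L[ℂ] E) c) v, v⟫_ℂ).re
      = (⟪T v, v⟫_ℂ).re - c * ‖v‖ ^ 2 := by
    rw [sub_apply, inner_sub_left, Complex.sub_re,
      Algebra.algebraMap_eq_smul_one, smul_apply,
      one_apply_eq_self, inner_smul_left_eq_smul, inner_self_eq_norm_sq_to_K]
    norm_cast
  rw [ContinuousLinearMap.isPositive_def]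
  constructor
  · intro h v
    have := h.2 v
    rw [ContinuousLinearMap.reApplyInnerSelf_apply, RCLike.re_eq_complex_re, key] at this
    linarith
  · refine fun h => ⟨(hT.sub hc).isSymmetric, fun v => ?_⟩
    rw [ContinuousLinearMap.reApplyInnerSelf_apply, RCLike.re_eq_complex_re, key]
    linarith [h v]

lemma sInf_spectrum_mul_norm_sq_le {T : E →L[ℂ] E} (hT : IsSelfAdjoint T) (v : E) :
    sInf (spectrum ℝ T) * ‖v‖ ^ 2 ≤ (⟪T v, v⟫_ℂ).re :=
  (forall_le_spectrum_iff hT _).1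
    (fun _ ht => csInf_le (spectrum.isCompact T).bddBelow ht) v

lemma abs_sInf_spectrum_le [Nontrivial E] {T : E →L[ℂ] E} (hT : IsSelfAdjoint T) :
    |sInf (spectrum ℝ T)| ≤ ‖T‖ := by
  have hne : (spectrum ℝ T).Nonempty := ContinuousFunctionalCalculus.spectrum_nonempty T hT
  exact spectrum.norm_le_norm_of_mem ((spectrum.isCompact T).sInf_mem hne)

lemma exists_inner_lt_sInf_spectrum_add [Nontrivial E] {T : E →L[ℂ] E} (hT : IsSelfAdjoint T)
    {δ : ℝ} (hδ : 0 < δ) :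
    ∃ v : E, ‖v‖ = 1 ∧ (⟪T v, v⟫_ℂ).re ≤ sInf (spectrum ℝ T) + δ := by
  have hne : (spectrum ℝ T).Nonempty := ContinuousFunctionalCalculus.spectrum_nonempty T hT
  by_contra! hcon
  have : sInf (spectrum ℝ T) + δ ≤ sInf (spectrum ℝ T) := by
    refine le_csInf hne ((forall_le_spectrum_iff hT _).2 fun v => ?_)
    rcases eq_or_ne v 0 with rfl | hv
    · simp
    have hv' : 0 < ‖v‖ := norm_pos_iff.2 hv
    have h1 := hcon (((‖v‖⁻¹ : ℝ) : ℂ) • v) (by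
      rw [norm_smul, Complex.norm_real, norm_inv, norm_norm, inv_mul_cancel₀ hv'.ne'])
    rw [map_smul, inner_smul_left, inner_smul_right, Complex.conj_ofReal, Complex.re_ofReal_mul,
      Complex.re_ofReal_mul, ← mul_assoc] at h1
    have h2 := mul_le_mul_of_nonneg_right h1.le (sq_nonneg ‖v‖)
    refine h2.trans_eq ?_
    field_simp
  linarith

/-- A nonnegative quadratic form controls the operator: `‖T u‖² ≤ C ⟪T u, u⟫`. -/
lemma norm_apply_sq_le_of_nonneg {T : E →L[ℂ] E} (hT : IsSelfAdjoint T)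
    (hpos : ∀ v, 0 ≤ (⟪T v, v⟫_ℂ).re) {C : ℝ} (hC : 0 < C) (hTC : ‖T‖ ≤ C) (u : E) :
    ‖T u‖ ^ 2 ≤ C * (⟪T u, u⟫_ℂ).re := by
  have h1 := hpos (u - ((C⁻¹ : ℝ) : ℂ) • T u)
  have hsym : ⟪T (T u), u⟫_ℂ = ⟪T u, T u⟫_ℂ := hT.isSymmetric (T u) u
  have hself : (⟪T u, T u⟫_ℂ).re = ‖T u‖ ^ 2 := inner_self_eq_norm_sq (𝕜 := ℂ) (T u)
  rw [map_sub, map_smul, inner_sub_left, inner_sub_right, inner_sub_right, inner_smul_left,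
    inner_smul_left, inner_smul_right, inner_smul_right, Complex.conj_ofReal, hsym] at h1
  simp only [Complex.sub_re, Complex.re_ofReal_mul, hself] at h1
  have h2 : (⟪T (T u), T u⟫_ℂ).re ≤ C * ‖T u‖ ^ 2 := by
    calc _ ≤ ‖⟪T (T u), T u⟫_ℂ‖ := Complex.re_le_norm _
      _ ≤ ‖T (T u)‖ * ‖T u‖ := norm_inner_le_norm _ _
      _ ≤ (C * ‖T u‖) * ‖T u‖ := by
        gcongr
        exact (T.le_opNorm _).trans (by gcongr)
      _ = _ := by ring
  have h3 : C⁻¹ * (C⁻¹ * (⟪T (T u), T u⟫_ℂ).re) ≤ C⁻¹ * (C⁻¹ * (C * ‖T u‖ ^ 2)) := by gcongr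
  rw [inv_mul_cancel_left₀ hC.ne'] at h3
  have h4 : C⁻¹ * ‖T u‖ ^ 2 ≤ (⟪T u, u⟫_ℂ).re := by linarith
  rwa [inv_mul_le_iff₀ hC] at h4

variable {F : Type*} [NormedAddCommGroup F] [InnerProductSpace ℂ F] [CompleteSpace F]

lemma LinearIsometry.adjoint_apply_apply (J : F →ₗᵢ[ℂ] E) (w : F) :
    J.toContinuousLinearMap.adjoint (J w) = w := by
  have := ContinuousLinearMap.norm_map_iff_adjoint_comp_self J.toContinuousLinearMap |>.1 J.norm_map
  exact congrArg (fun S : F →L[ℂ] F => S w) this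

/-- The compression of `A` along the isometry `J`. -/
def compression (A : E →L[ℂ] E) (J : F →ₗᵢ[ℂ] E) : F →L[ℂ] F :=
  J.toContinuousLinearMap.adjoint ∘L A ∘L J.toContinuousLinearMap

lemma compression_apply (A : E →L[ℂ] E) (J : F →ₗᵢ[ℂ] E) (w : F) :
    compression A J w = J.toContinuousLinearMap.adjoint (A (J w)) := rfl

lemma isSelfAdjoint_compression {A : E →L[ℂ] E} (hA : IsSelfAdjoint A) (J : F →ₗᵢ[ℂ] E) :
    IsSelfAdjoint (compression A J) := hA.adjoint_conj _

lemma norm_adjoint_apply_le (J : F →ₗᵢ[ℂ] E) (v : E) :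
    ‖J.toContinuousLinearMap.adjoint v‖ ≤ ‖v‖ := by
  refine (ContinuousLinearMap.le_opNorm _ v).trans ?_
  rw [LinearIsometryEquiv.norm_map]
  exact mul_le_of_le_one_left (norm_nonneg _) J.norm_toContinuousLinearMap_le

lemma norm_compression_le (A : E →L[ℂ] E) (J : F →ₗᵢ[ℂ] E) : ‖compression A J‖ ≤ ‖A‖ := by
  refine ContinuousLinearMap.opNorm_le_bound _ (norm_nonneg _) fun w => ?_
  rw [compression_apply]
  refine (norm_adjoint_apply_le J _).trans ((A.le_opNorm _).trans_eq ?_)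
  rw [J.norm_map]

lemma inner_compression (A : E →L[ℂ] E) (J : F →ₗᵢ[ℂ] E) (w : F) :
    ⟪compression A J w, w⟫_ℂ = ⟪A (J w), J w⟫_ℂ := by
  rw [compression_apply, ContinuousLinearMap.adjoint_inner_left]
  rfl

/-- Below the spectrum of a compression of `A` to a subspace with compact complementary
projection, `A - t` is invertible modulo compact operators. -/
lemma exists_compact_parametrix {A : E →L[ℂ] E} (hA : IsSelfAdjoint A) (J : F →ₗᵢ[ℂ] E)
    (hQ : IsCompactOperator
      ⇑(1 - J.toContinuousLinearMap ∘L J.toContinuousLinearMap.adjoint : E →L[ℂ] E))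
    {t : ℝ} (ht : t < sInf (spectrum ℝ (compression A J))) :
    ∃ S : E →L[ℂ] E, IsCompactOperator ⇑(S * (A - (t : ℂ) • 1) - 1) ∧
      IsCompactOperator ⇑((A - (t : ℂ) • 1) * S - 1) := by
  set a := sInf (spectrum ℝ (compression A J))
  set j := J.toContinuousLinearMap
  obtain ⟨P, hP⟩ : ∃ P : E →L[ℂ] E, P = j ∘L j.adjoint := ⟨_, rfl⟩
  rw [← hP] at hQ
  have hPv (v : E) : P v = J (j.adjoint v) := by rw [hP]; rfl
  have hPsa : IsSelfAdjoint P := by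
    rw [IsSelfAdjoint, ContinuousLinearMap.star_eq_adjoint, hP, ContinuousLinearMap.adjoint_comp,
      ContinuousLinearMap.adjoint_adjoint]
  set B : E →L[ℂ] E := P * A * P + (a : ℂ) • (1 - P)
  have hBsa : IsSelfAdjoint B := by
    have h1 : IsSelfAdjoint (P * A * P) := by
      simpa [hPsa.star_eq] using hA.conjugate P
    have ha : IsSelfAdjoint (a : ℂ) := Complex.conj_ofReal a
    have h2 : IsSelfAdjoint ((a : ℂ) • (1 - P)) := ha.smul ((IsSelfAdjoint.one _).sub hPsa)
    exact h1.add h2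
  have hlow : ∀ s ∈ spectrum ℝ B, a ≤ s := by
    rw [forall_le_spectrum_iff hBsa]
    intro v
    have h1 := sInf_spectrum_mul_norm_sq_le (isSelfAdjoint_compression hA J) (j.adjoint v)
    rw [inner_compression] at h1
    have h2 : ⟪(P * A * P) v, v⟫_ℂ = ⟪A (J (j.adjoint v)), J (j.adjoint v)⟫_ℂ := by
      rw [← hPv]
      exact hPsa.isSymmetric (A (P v)) v
    have h3 : ⟪P v, v⟫_ℂ = ⟪j.adjoint v, j.adjoint v⟫_ℂ := by
      rw [hPv]
      exact (ContinuousLinearMap.adjoint_inner_right j (j.adjoint v) v).symm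
    have h4 : (⟪j.adjoint v, j.adjoint v⟫_ℂ).re = ‖j.adjoint v‖ ^ 2 :=
      inner_self_eq_norm_sq (𝕜 := ℂ) _
    have h5 : (⟪v, v⟫_ℂ).re = ‖v‖ ^ 2 := inner_self_eq_norm_sq (𝕜 := ℂ) _
    have h6 : (⟪B v, v⟫_ℂ).re
        = (⟪(P * A * P) v, v⟫_ℂ).re + a * (‖v‖ ^ 2 - ‖j.adjoint v‖ ^ 2) := by
      rw [← h4, ← h5, ← h3, ← Complex.sub_re, ← inner_sub_left, ← Complex.re_ofReal_mul,
        ← Complex.add_re]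
      congr 1
      change ⟪(P * A * P) v + (a : ℂ) • (v - P v), v⟫_ℂ = _
      rw [inner_add_left, inner_smul_left, Complex.conj_ofReal]
    rw [h6, h2]
    linarith
  have htB : t ∉ spectrum ℝ B := fun h => absurd (hlow t h) (not_le.2 ht)
  rw [spectrum.notMem_iff] at htB
  have hu : IsUnit (B - (t : ℂ) • 1) := by
    have : B - (t : ℂ) • 1 = -(algebraMap ℝ (E →L[ℂ] E) t - B) := by
      rw [Algebra.algebraMap_eq_smul_one, neg_sub]
      rfl
    rw [this]
    exact htB.neg
  obtain ⟨U, hU⟩ := hu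
  have hK : IsCompactOperator ⇑(A - B) := by
    have : A - B = (1 - P) * A + (P * A) * (1 - P) - (a : ℂ) • (1 - P) := by
      simp only [B]; noncomm_ring
    rw [this]
    exact ((hQ.comp_clm A).add (hQ.clm_comp (P * A))).sub (hQ.smul (a : ℂ))
  have hdiff : A - B = (A - (t : ℂ) • 1) - U := by rw [hU, sub_sub_sub_cancel_right]
  refine ⟨↑U⁻¹, ?_, ?_⟩
  · have : (↑U⁻¹ : E →L[ℂ] E) * (A - (t : ℂ) • 1) - 1 = ↑U⁻¹ * (A - B) := by
      rw [hdiff, mul_sub _ _ (U : E →L[ℂ] E), U.inv_mul]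
    rw [this]
    exact hK.clm_comp _
  · have : (A - (t : ℂ) • 1) * (↑U⁻¹ : E →L[ℂ] E) - 1 = (A - B) * ↑U⁻¹ := by
      rw [hdiff, sub_mul _ (U : E →L[ℂ] E), U.mul_inv]
    rw [this]
    exact hK.comp_clm _

/-- A compact operator cannot be bounded below along vectors going weakly to zero. -/
lemma frequently_norm_apply_lt_of_isCompactOperator {ι : Type*} {l : Filter ι} [l.NeBot]
    {K : E →L[ℂ] E} (hK : IsCompactOperator ⇑K) {v : ι → E} (hv : ∀ i, ‖v i‖ ≤ 1)
    (hweak : ∀ u, Tendsto (fun i => ⟪u, v i⟫_ℂ) l (𝓝 0)) {ε : ℝ} (hε : 0 < ε) :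
    ∃ᶠ i in l, ‖K (v i)‖ < ε := by
  obtain ⟨C, hC, hCsub⟩ := IsCompactOperator.image_closedBall_subset_compact (f := (K : E →ₗ[ℂ] E)) hK 1
  let U := Ultrafilter.of l
  have hU : (U : Filter ι) ≤ l := Ultrafilter.of_le l
  obtain ⟨c, -, hc⟩ := hC.ultrafilter_le_nhds (U.map fun i => K (v i)) (by
    refine le_principal_iff.2 (Eventually.of_forall (f := (U : Filter ι)) fun i => ?_)
    exact hCsub ⟨v i, by simpa using hv i, rfl⟩)
  have hc' : Tendsto (fun i => K (v i)) U (𝓝 c) := hc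
  have h1 : Tendsto (fun i => ⟪c, K (v i)⟫_ℂ) U (𝓝 ⟪c, c⟫_ℂ) := tendsto_const_nhds.inner hc'
  have h2 : Tendsto (fun i => ⟪c, K (v i)⟫_ℂ) U (𝓝 0) := by
    simp_rw [← ContinuousLinearMap.adjoint_inner_left]
    exact (hweak _).mono_left hU
  have h3 : c = 0 := inner_self_eq_zero.1 (tendsto_nhds_unique h1 h2)
  rw [h3] at hc'
  exact (hc'.norm.eventually_lt_const (by simpa using hε)).frequently.filter_mono hU

/-- **Abstract Persson formula**: the essential spectrum of a self-adjoint operator has a least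
element, the supremum of the bottoms of the spectra of its compressions to subspaces with compact
complementary projection escaping to infinity. -/
lemma isLeast_iSup_sInf_spectrum_compression {ι : Type*} [Nonempty ι] [Preorder ι]
    [IsDirected ι (· ≤ ·)] {G : ι → Type*} [∀ i, NormedAddCommGroup (G i)]
    [∀ i, InnerProductSpace ℂ (G i)] [∀ i, CompleteSpace (G i)] [∀ i, Nontrivial (G i)]
    {A : E →L[ℂ] E} (hA : IsSelfAdjoint A) (J : ∀ i, G i →ₗᵢ[ℂ] E)
    (hQ : ∀ i, IsCompactOperator
      ⇑(1 - (J i).toContinuousLinearMap ∘L (J i).toContinuousLinearMap.adjoint : E →L[ℂ] E))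
    (hloc : ∀ i, ∀ᶠ j in atTop, ∀ w : G j,
      J j w ∈ Set.range (J i) ∧ A (J j w) ∈ Set.range (J i))
    (hesc : ∀ u : E, Tendsto (fun i => ‖(J i).toContinuousLinearMap.adjoint u‖) atTop (𝓝 0)) :
    IsLeast {t : ℝ | ¬ ∃ S : E →L[ℂ] E, IsCompactOperator ⇑(S * (A - (t : ℂ) • 1) - 1) ∧
        IsCompactOperator ⇑((A - (t : ℂ) • 1) * S - 1)}
      (⨆ i, sInf (spectrum ℝ (compression A (J i)))) := by
  set B := fun i => compression A (J i)
  set a := fun i => sInf (spectrum ℝ (B i))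
  have hB (i) : IsSelfAdjoint (B i) := isSelfAdjoint_compression hA (J i)
  have habs (i) : |a i| ≤ ‖A‖ := (abs_sInf_spectrum_le (hB i)).trans (norm_compression_le A (J i))
  have hbdd : BddAbove (Set.range a) :=
    ⟨‖A‖, by rintro _ ⟨i, rfl⟩; exact (le_abs_self _).trans (habs i)⟩
  refine ⟨?_, fun t ht => ciSup_le fun i => ?_⟩
  swap
  · by_contra! hlt
    exact ht (exists_compact_parametrix hA (J i) (hQ i) hlt)
  set s := ⨆ i, a i
  have hweyl {ε : ℝ} (hε : 0 < ε) :
      ∀ᶠ j in atTop, ∃ w : G j, ‖w‖ = 1 ∧ ‖(A - (s : ℂ) • 1) (J j w)‖ ≤ ε := by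
    obtain ⟨C, hC, hCA⟩ : ∃ C : ℝ, 0 < C ∧ 2 * ‖A‖ ≤ C := ⟨2 * ‖A‖ + 1, by positivity, by simp⟩
    obtain ⟨δ, hδ, hδε, hδC⟩ : ∃ δ : ℝ, 0 < δ ∧ δ ≤ ε / 2 ∧ C * (2 * δ) ≤ (ε / 2) ^ 2 := by
      refine ⟨min (ε / 2) ((ε / 2) ^ 2 / (C * 2)), by positivity, min_le_left _ _, ?_⟩
      rw [← mul_assoc, ← le_div_iff₀' (by positivity)]
      exact min_le_right _ _
    obtain ⟨i, hi⟩ := exists_lt_of_lt_ciSup (sub_lt_self s hδ)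
    filter_upwards [hloc i] with j hj
    obtain ⟨w, hw, hwle⟩ := exists_inner_lt_sInf_spectrum_add (hB j) hδ
    obtain ⟨⟨u, hu⟩, y, hy⟩ := hj w
    refine ⟨w, hw, ?_⟩
    have hun : ‖u‖ = 1 := by rw [← (J i).norm_map, hu, (J j).norm_map, hw]
    have hBu : B i u = y := by
      rw [compression_apply, hu, ← hy, LinearIsometry.adjoint_apply_apply]
    have hsplit : (A - (s : ℂ) • 1) (J j w)
        = J i ((B i - (a i : ℂ) • 1) u - ((s - a i : ℝ) : ℂ) • u) := by
      have h1 : (B i - (a i : ℂ) • 1) u - ((s - a i : ℝ) : ℂ) • u = y - (s : ℂ) • u := by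
        rw [← hBu]
        change B i u - (a i : ℂ) • u - _ = _
        rw [Complex.ofReal_sub, sub_smul]
        abel
      rw [h1, map_sub, map_smul, hy, hu]
      rfl
    have hform (v : G i) : (⟪(B i - (a i : ℂ) • 1) v, v⟫_ℂ).re
        = (⟪B i v, v⟫_ℂ).re - a i * ‖v‖ ^ 2 := by
      have h5 : (⟪v, v⟫_ℂ).re = ‖v‖ ^ 2 := inner_self_eq_norm_sq (𝕜 := ℂ) _
      change (⟪B i v - (a i : ℂ) • v, v⟫_ℂ).re = _
      rw [inner_sub_left, inner_smul_left, Complex.conj_ofReal, Complex.sub_re,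
        Complex.re_ofReal_mul, h5]
    have hsa : IsSelfAdjoint (B i - (a i : ℂ) • 1) := by
      have ha : IsSelfAdjoint (a i : ℂ) := Complex.conj_ofReal _
      have h1 : IsSelfAdjoint ((a i : ℂ) • (1 : G i →L[ℂ] G i)) := ha.smul (IsSelfAdjoint.one _)
      exact (hB i).sub h1
    have hnorm : ‖B i - (a i : ℂ) • 1‖ ≤ C := by
      refine (norm_sub_le _ _).trans (le_trans ?_ hCA)
      rw [norm_smul, norm_one, mul_one, Complex.norm_real, Real.norm_eq_abs, two_mul]
      exact add_le_add (norm_compression_le A (J i)) (habs i)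
    have hinner : ⟪B i u, u⟫_ℂ = ⟪B j w, w⟫_ℂ := by
      rw [inner_compression, inner_compression, hu]
    have hsq : ‖(B i - (a i : ℂ) • 1) u‖ ^ 2 ≤ (ε / 2) ^ 2 := by
      refine (norm_apply_sq_le_of_nonneg hsa (fun v => ?_) hC hnorm u).trans
        (le_trans ?_ hδC)
      · rw [hform]
        exact sub_nonneg.2 (sInf_spectrum_mul_norm_sq_le (hB i) v)
      · gcongr
        rw [hform, hinner, hun]
        have : a j ≤ s := le_ciSup hbdd j
        linarith
    have hsle : a i ≤ s := le_ciSup hbdd i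
    rw [hsplit, (J i).norm_map]
    refine (norm_sub_le _ _).trans ?_
    rw [norm_smul, hun, mul_one, Complex.norm_real, Real.norm_of_nonneg (sub_nonneg.2 hsle)]
    have := (sq_le_sq₀ (norm_nonneg _) (by positivity)).1 hsq
    linarith
  rintro ⟨S, hS, -⟩
  obtain ⟨ε, hε, hSε⟩ : ∃ ε : ℝ, 0 < ε ∧ ‖S‖ * ε ≤ 1 / 2 := by
    refine ⟨1 / (2 * (‖S‖ + 1)), by positivity, ?_⟩
    rw [mul_one_div, div_le_div_iff₀ (by positivity) two_pos]
    linarith [norm_nonneg S]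
  have hex (j) : ∃ w : G j, ‖w‖ = 1 ∧
      ((∃ w : G j, ‖w‖ = 1 ∧ ‖(A - (s : ℂ) • 1) (J j w)‖ ≤ ε) →
        ‖(A - (s : ℂ) • 1) (J j w)‖ ≤ ε) := by
    by_cases hj : ∃ w : G j, ‖w‖ = 1 ∧ ‖(A - (s : ℂ) • 1) (J j w)‖ ≤ ε
    · obtain ⟨w, hw, hwε⟩ := hj
      exact ⟨w, hw, fun _ => hwε⟩
    · obtain ⟨w, hw, -⟩ := exists_inner_lt_sInf_spectrum_add (hB j) one_pos
      exact ⟨w, hw, fun h => (hj h).elim⟩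
  choose w hw hwε using hex
  have hv (j) : ‖J j (w j)‖ = 1 := by rw [(J j).norm_map, hw]
  have hweak (u : E) : Tendsto (fun j => ⟪u, J j (w j)⟫_ℂ) atTop (𝓝 0) := by
    refine squeeze_zero_norm (fun j => ?_) (hesc u)
    have : ⟪u, J j (w j)⟫_ℂ = ⟪(J j).toContinuousLinearMap.adjoint u, w j⟫_ℂ :=
      (ContinuousLinearMap.adjoint_inner_left (J j).toContinuousLinearMap (w j) u).symm
    rw [this]
    exact (norm_inner_le_norm _ _).trans_eq (by rw [hw, mul_one])
  obtain ⟨j, hjK, hj⟩ := ((frequently_norm_apply_lt_of_isCompactOperator hS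
    (fun j => (hv j).le) hweak one_half_pos).and_eventually (hweyl hε)).exists
  have hle : ‖J j (w j)‖ ≤ ‖S ((A - (s : ℂ) • 1) (J j (w j)))‖
      + ‖(S * (A - (s : ℂ) • 1) - 1) (J j (w j))‖ := by
    refine le_trans (le_of_eq ?_) (norm_sub_le _ _)
    congr 1
    exact (sub_sub_cancel _ _).symm
  have hle' : ‖S ((A - (s : ℂ) • 1) (J j (w j)))‖ ≤ ‖S‖ * ε :=
    (S.le_opNorm _).trans (by gcongr; exact hwε j hj)
  rw [hv] at hle
  linarith

end Hilbert
section SequenceSpace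

lemma lp_inner_single_one_left {X : Type} [DecidableEq X] (x : X) (v : l2 X) :
    ⟪(lp.single 2 x (1 : ℂ) : l2 X), v⟫_ℂ = v x := by
  rw [lp.inner_single_left]; simp

open Classical in
lemma orthonormal_single_comp {X Y : Type} (e : Y ↪ X) :
    Orthonormal ℂ fun y => (lp.single 2 (e y) (1 : ℂ) : l2 X) := by
  rw [orthonormal_iff_ite]
  intro y y'
  rw [lp_inner_single_one_left, lp.single_apply, Pi.single_apply]
  simp

/-- Extension by zero `ℓ²(Y) → ℓ²(X)` along an embedding `Y ↪ X`. -/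
def extendByZero {X Y : Type} (e : Y ↪ X) : l2 Y →ₗᵢ[ℂ] l2 X :=
  (orthonormal_single_comp e).orthogonalFamily.linearIsometry

variable {X Y : Type} (e : Y ↪ X)

lemma adjoint_extendByZero_apply (v : l2 X) (y : Y) :
    (extendByZero e).toContinuousLinearMap.adjoint v y = v (e y) := by
  classical
  rw [← lp_inner_single_one_left, ContinuousLinearMap.adjoint_inner_right, ← lp_inner_single_one_left]
  congr 1
  refine ((orthonormal_single_comp e).orthogonalFamily.linearIsometry_apply_single (1 : ℂ)).trans ?_
  rw [LinearIsometry.toSpanSingleton_apply, one_smul]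

lemma extendByZero_apply (w : l2 Y) (y : Y) : extendByZero e w (e y) = w y := by
  rw [← adjoint_extendByZero_apply, LinearIsometry.adjoint_apply_apply]

lemma extendByZero_apply_of_notMem (w : l2 Y) {x : X} (hx : x ∉ Set.range e) :
    extendByZero e w x = 0 := by
  classical
  have h0 : (extendByZero e).toContinuousLinearMap.adjoint (lp.single 2 x (1 : ℂ)) = 0 := by
    ext y
    rw [adjoint_extendByZero_apply, lp.single_apply_ne]
    · rfl
    · rintro rfl
      exact hx ⟨y, rfl⟩
  rw [← lp_inner_single_one_left]
  have := ContinuousLinearMap.adjoint_inner_left (extendByZero e).toContinuousLinearMap w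
    (lp.single 2 x (1 : ℂ))
  rw [h0, inner_zero_left] at this
  exact this.symm

lemma mem_range_extendByZero {v : l2 X} (hv : ∀ x ∉ Set.range e, v x = 0) :
    v ∈ Set.range (extendByZero e) := by
  refine ⟨(extendByZero e).toContinuousLinearMap.adjoint v, ?_⟩
  ext x
  by_cases hx : x ∈ Set.range e
  · obtain ⟨y, rfl⟩ := hx
    rw [extendByZero_apply, adjoint_extendByZero_apply]
  · rw [extendByZero_apply_of_notMem e _ hx, hv x hx]

lemma isCompactOperator_one_sub_extendByZero (hfin : (Set.range e)ᶜ.Finite) :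
    IsCompactOperator ⇑(1 - (extendByZero e).toContinuousLinearMap ∘L
      (extendByZero e).toContinuousLinearMap.adjoint : l2 X →L[ℂ] l2 X) := by
  classical
  have key : (1 - (extendByZero e).toContinuousLinearMap ∘L
      (extendByZero e).toContinuousLinearMap.adjoint : l2 X →L[ℂ] l2 X) =
      ∑ x ∈ hfin.toFinset, (ContinuousLinearMap.toSpanSingleton ℂ (lp.single 2 x (1 : ℂ) : l2 X)) ∘L
        innerSL ℂ (lp.single 2 x (1 : ℂ) : l2 X) := by
    ext v x
    have hr : (∑ x ∈ hfin.toFinset, (ContinuousLinearMap.toSpanSingleton ℂ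
        (lp.single 2 x (1 : ℂ) : l2 X)) ∘L innerSL ℂ (lp.single 2 x (1 : ℂ) : l2 X)) v x
        = ∑ x' ∈ hfin.toFinset, v x' * Pi.single (M := fun _ => ℂ) x' (1 : ℂ) x := by
      rw [sum_apply, lp.coeFn_sum, Finset.sum_apply]
      refine Finset.sum_congr rfl fun x' _ => ?_
      rw [ContinuousLinearMap.comp_apply, innerSL_apply_apply, lp_inner_single_one_left,
        ContinuousLinearMap.toSpanSingleton_apply]
      rfl
    rw [hr]
    change v x - extendByZero e ((extendByZero e).toContinuousLinearMap.adjoint v) x = _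
    simp only [Pi.single_apply, mul_ite, mul_one, mul_zero, Finset.sum_ite_eq,
      Set.Finite.mem_toFinset, Set.mem_compl_iff]
    by_cases hx : x ∈ Set.range e
    · rw [if_neg (not_not.2 hx)]
      obtain ⟨y, rfl⟩ := hx
      rw [extendByZero_apply, adjoint_extendByZero_apply, sub_self]
    · rw [extendByZero_apply_of_notMem e _ hx, if_pos hx, sub_zero]
  rw [key]
  refine Submodule.sum_mem (compactOperator (RingHom.id ℂ) (l2 X) (l2 X)) fun x _ => ?_
  have h1 : IsCompactOperator ⇑(ContinuousLinearMap.toSpanSingleton ℂ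
      (lp.single 2 x (1 : ℂ) : l2 X)) :=
    isCompactOperator_of_locallyCompactSpace_rng _
  exact h1.comp_clm (innerSL ℂ (lp.single 2 x (1 : ℂ) : l2 X))

lemma isLeast_essSpectrum [Infinite X] {ι : Type} [Nonempty ι] [Preorder ι]
    [IsDirected ι (· ≤ ·)] {Y : ι → Type} (e : ∀ i, Y i ↪ X)
    (hfin : ∀ i, (Set.range (e i))ᶜ.Finite)
    (hesc : ∀ x, ∀ᶠ i in atTop, x ∉ Set.range (e i))
    {A : l2 X →L[ℂ] l2 X} (hA : IsSelfAdjoint A)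
    (hloc : ∀ x, ∃ N : Set X, N.Finite ∧ ∀ v : l2 X, (∀ y ∈ N, v y = 0) → A v x = 0)
    {B : ∀ i, l2 (Y i) →L[ℂ] l2 (Y i)}
    (hB : ∀ i w y, B i w y = A (extendByZero (e i) w) (e i y)) :
    IsLeast (essSpectrum A) (⨆ i, sInf (spectrum ℝ (B i))) := by
  have hBc (i) : B i = compression A (extendByZero (e i)) := by
    ext w y
    rw [hB, compression_apply, adjoint_extendByZero_apply]
  have hnt (i) : Nontrivial (l2 (Y i)) := by
    classical
    obtain ⟨y⟩ : Nonempty (Y i) := by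
      by_contra hemp
      rw [not_nonempty_iff] at hemp
      exact Set.infinite_univ (α := X) (by simpa [Set.range_eq_empty] using hfin i)
    refine ⟨lp.single 2 y 1, 0, fun h => ?_⟩
    simpa using congrArg (fun v : l2 (Y i) => v y) h
  have := isLeast_iSup_sInf_spectrum_compression hA (fun i => extendByZero (e i))
    (fun i => isCompactOperator_one_sub_extendByZero _ (hfin i)) ?_ ?_
  · convert this using 4 with i
    · rfl
    rw [hBc, ← spectrum.preimage_algebraMap (R := ℝ) ℂ, ← spectrum.preimage_algebraMap (R := ℝ) ℂ]
  · intro i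
    choose N hN hNv using hloc
    have hNi : ((Set.range (e i))ᶜ ∪ ⋃ x ∈ (Set.range (e i))ᶜ, N x).Finite :=
      (hfin i).union ((hfin i).biUnion fun x _ => hN x)
    filter_upwards [(eventually_all_finite hNi).2 fun x _ => hesc x] with j hj w
    constructor
    · exact mem_range_extendByZero _ fun x hx =>
        extendByZero_apply_of_notMem _ _ (hj x (Or.inl hx))
    · exact mem_range_extendByZero _ fun x hx => hNv x _ fun y hy =>
        extendByZero_apply_of_notMem _ _ (hj y (Or.inr (Set.mem_biUnion hx hy)))
  · intro u
    classical
    rw [Metric.tendsto_nhds]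
    intro ε hε
    obtain ⟨s, hs⟩ := ((lp.hasSum_single ENNReal.ofNat_ne_top u).eventually
      (Metric.ball_mem_nhds u hε)).exists
    filter_upwards [(eventually_all_finset s).2 fun x _ => hesc x] with i hi
    have h0 : (extendByZero (e i)).toContinuousLinearMap.adjoint
        (∑ x ∈ s, lp.single 2 x (u x)) = 0 := by
      ext y
      rw [adjoint_extendByZero_apply, lp.coeFn_sum, Finset.sum_apply]
      refine Finset.sum_eq_zero fun x hx => lp.single_apply_ne _ _ _ ?_
      rintro rfl
      exact hi _ hx ⟨y, rfl⟩
    rw [dist_zero_right, norm_norm, ← sub_zero (ContinuousLinearMap.adjoint _ u), ← h0, ← map_sub]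
    refine (norm_adjoint_apply_le _ _).trans_lt ?_
    rwa [← dist_eq_norm, dist_comm]

lemma essSpectrum_neg (A : l2 X →L[ℂ] l2 X) : essSpectrum (-A) = -essSpectrum A := by
  have key (A : l2 X →L[ℂ] l2 X) (t : ℝ) (h : -t ∉ essSpectrum A) : t ∉ essSpectrum (-A) := by
    simp only [essSpectrum, Set.mem_ofPred_eq, not_not] at h ⊢
    obtain ⟨S, h1, h2⟩ := h
    have h3 : -A - (t : ℂ) • 1 = -(A - ((-t : ℝ) : ℂ) • 1) := by
      push_cast
      rw [neg_smul]
      abel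
    refine ⟨-S, ?_, ?_⟩
    · rwa [h3, neg_mul_neg]
    · rwa [h3, neg_mul_neg]
  ext t
  refine not_iff_not.1 ⟨fun h => ?_, key A t⟩
  rw [← neg_neg A]
  exact key (-A) (-t) (by rwa [neg_neg])

lemma isGreatest_essSpectrum [Infinite X] {ι : Type} [Nonempty ι] [Preorder ι]
    [IsDirected ι (· ≤ ·)] {Y : ι → Type} (e : ∀ i, Y i ↪ X)
    (hfin : ∀ i, (Set.range (e i))ᶜ.Finite)
    (hesc : ∀ x, ∀ᶠ i in atTop, x ∉ Set.range (e i))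
    {A : l2 X →L[ℂ] l2 X} (hA : IsSelfAdjoint A)
    (hloc : ∀ x, ∃ N : Set X, N.Finite ∧ ∀ v : l2 X, (∀ y ∈ N, v y = 0) → A v x = 0)
    {B : ∀ i, l2 (Y i) →L[ℂ] l2 (Y i)}
    (hB : ∀ i w y, B i w y = A (extendByZero (e i) w) (e i y)) :
    IsGreatest (essSpectrum A) (⨅ i, sSup (spectrum ℝ (B i))) := by
  have h := isLeast_essSpectrum e hfin hesc hA.neg (B := fun i => -B i) (fun x => ?_)
    (fun i w y => congrArg Neg.neg (hB i w y))
  · have hsup : (⨆ i, sInf (spectrum ℝ (-B i))) = -⨅ i, sSup (spectrum ℝ (B i)) := by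
      simp_rw [← spectrum.neg_eq, Real.sInf_neg]
      rw [iSup, iInf, ← Real.sSup_neg]
      congr 1
      ext t
      simp [neg_eq_iff_eq_neg, eq_comm]
    rw [hsup, essSpectrum_neg] at h
    refine ⟨by simpa using h.1, fun t ht => ?_⟩
    have := h.2 (show -t ∈ -essSpectrum A by simpa using ht)
    linarith
  · obtain ⟨N, hN, hNv⟩ := hloc x
    refine ⟨N, hN, fun v hv => ?_⟩
    change -(A v x) = 0
    rw [hNv v hv, neg_zero]

/-- An operator on `ℓ²(X)` is self-adjoint if its matrix is Hermitian. -/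
lemma isSelfAdjoint_of_forall_single [DecidableEq X] {A : l2 X →L[ℂ] l2 X}
    (hA : ∀ x y, A (lp.single 2 x 1) y = starRingEnd ℂ (A (lp.single 2 y 1) x)) :
    IsSelfAdjoint A := by
  rw [IsSelfAdjoint, ContinuousLinearMap.star_eq_adjoint]
  refine lp.ext_continuousLinearMap ENNReal.ofNat_ne_top fun x => ?_
  ext y
  change A.adjoint (lp.single 2 x 1) y = A (lp.single 2 x 1) y
  rw [hA, ← lp_inner_single_one_left, ContinuousLinearMap.adjoint_inner_right, ← inner_conj_symm,
    lp_inner_single_one_left]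

end SequenceSpace

section Shift

variable {𝒜 : Type}

lemma tau_tau (k l : ℤ) (x : ℤ → 𝒜) : tau k (tau l x) = tau (l + k) x := by
  funext n
  simp only [tau]
  congr 1
  ring

lemma tau_injective_of_not_periodic {z : ℤ → 𝒜}
    (hper : ¬ ∃ p : ℤ, p ≠ 0 ∧ ∀ k : ℤ, z (k + p) = z k) :
    Function.Injective fun k => tau k z := by
  intro k l hkl
  by_contra hne
  refine hper ⟨k - l, sub_ne_zero.2 hne, fun n => ?_⟩
  have := congrFun hkl (n + k)
  simp only [tau, add_sub_cancel_right] at this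
  rw [this, add_sub_assoc]

end Shift

/-- **Persson's formula for the essential spectrum over an admissible orbit closure**
(Corollary 7.9 of the paper). `z ∈ 𝒜^ℤ` is admissible (non-periodic with orbit `O` open in
its closure `X`), `X₀ := O`, `X∞ := X \ O`, and `(M i)` is a net of clopen subsets of `X`
containing `X∞`, with finite complement `X \ M i ⊆ X₀`, Fell-converging to `X∞`.  For
self-adjoint, compactly supported continuous `h : X × ℤ → ℂ`, `H = H_X` acts on `ℓ²(X₀)` and
`H_{M i}` acts on `ℓ²(M i \ X∞)` via the formula
`[H_M v](x) = Σ_{-l ∈ ℤ_x(M)} h(τ_{-l}(x), l) v(τ_{-l}(x))`. Then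
`inf sp_ess(H) = sup_i inf sp(H_{M i})` and `sup sp_ess(H) = inf_i sup sp(H_{M i})`. -/
theorem persson_essential_subshift
    {𝒜 : Type} [Fintype 𝒜] [TopologicalSpace 𝒜] [DiscreteTopology 𝒜]
    (z : ℤ → 𝒜)
    (O Xc Xinf : Set (ℤ → 𝒜))
    (hO : O = Set.range fun k => tau k z)
    (hXc : Xc = closure O)
    (hXinf : Xinf = Xc \ O)
    -- z is admissible: not periodic, with orbit open in the orbit closure
    (hper : ¬ ∃ p : ℤ, p ≠ 0 ∧ ∀ k : ℤ, z (k + p) = z k)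
    (horb_open : IsOpen {p : Xc | ↑p ∈ O})
    -- the net of clopen subsets of X
    {ι : Type} [Nonempty ι] [Preorder ι] [IsDirected ι (· ≤ ·)]
    (M : ι → Set (ℤ → 𝒜))
    (hMX : ∀ i, M i ⊆ Xc)
    (hMclopen : ∀ i, IsClopen {p : Xc | ↑p ∈ M i})
    (hMinf : ∀ i, Xinf ⊆ M i)
    (hMfin : ∀ i, (Xc \ M i).Finite ∧ Xc \ M i ⊆ O)
    -- Fell convergence M i → X∞
    (hFell : ∀ K ⊆ Xc, IsCompact K → K ∩ Xinf = ∅ → ∃ i₀, ∀ i ≥ i₀, M i ∩ K = ∅)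
    -- h : X × ℤ → ℂ continuous with compact support and self-adjoint
    (h : (ℤ → 𝒜) → ℤ → ℂ)
    (hcont : ∀ k : ℤ, ContinuousOn (fun x => h x k) Xc)
    (hsupp : ∃ r > (0 : ℝ), ∀ (x : ℤ → 𝒜) (k : ℤ), (|k| : ℝ) > r → h x k = 0)
    (hsa : ∀ x ∈ Xc, ∀ k : ℤ, h (tau k x) (-k) = starRingEnd ℂ (h x k))
    -- the operator H = H_X on ℓ²(X₀)
    (H : l2 ↥O →L[ℂ] l2 ↥O)
    (hHdef : ∀ (v : l2 ↥O) (x : ↥O),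
      (H v) x = ∑' l : {l : ℤ // tau (-l) (↑x : ℤ → 𝒜) ∈ O},
        h (tau (-(l : ℤ)) ↑x) (l : ℤ) * v ⟨tau (-(l : ℤ)) ↑x, l.2⟩)
    -- the compressions H_{M i} on ℓ²(M i \ X∞)
    (HM : (i : ι) → (l2 ↥(M i \ Xinf) →L[ℂ] l2 ↥(M i \ Xinf)))
    (hHM : ∀ (i : ι) (v : l2 ↥(M i \ Xinf)) (x : ↥(M i \ Xinf)),
      (HM i v) x = ∑' l : {l : ℤ // tau (-l) (↑x : ℤ → 𝒜) ∈ M i \ Xinf},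
        h (tau (-(l : ℤ)) ↑x) (l : ℤ) * v ⟨tau (-(l : ℤ)) ↑x, l.2⟩) :
    (sInf (essSpectrum H) = ⨆ i, sInf (spectrum ℝ (HM i))) ∧
    (sSup (essSpectrum H) = ⨅ i, sSup (spectrum ℝ (HM i))) := by
  have hinj := tau_injective_of_not_periodic hper
  have hOX : O ⊆ Xc := hXc ▸ subset_closure
  have hOinf : ∀ x ∈ O, x ∉ Xinf := fun x hx hx' => (hXinf ▸ hx').2 hx
  have hMO (i) : M i \ Xinf ⊆ O := by
    intro x hx
    by_contra hxO
    exact hx.2 (hXinf ▸ ⟨hMX i hx.1, hxO⟩)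
  have hOinfinite : Infinite O := by
    rw [Set.infinite_coe_iff, hO]
    exact Set.infinite_range_of_injective hinj
  let e (i) : ↥(M i \ Xinf) ↪ O := Set.embeddingOfSubset _ _ (hMO i)
  have he (i) (x : O) : x ∈ Set.range (e i) ↔ (x : ℤ → 𝒜) ∈ M i := by
    constructor
    · rintro ⟨y, rfl⟩
      exact y.2.1
    · exact fun hx => ⟨⟨x, hx, hOinf x x.2⟩, rfl⟩
  have hfin (i) : (Set.range (e i))ᶜ.Finite := by
    refine ((hMfin i).1.preimage Subtype.val_injective.injOn).subset fun x hx => ?_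
    exact ⟨hOX x.2, fun h => hx ((he i x).2 h)⟩
  have hesc (x : O) : ∀ᶠ i in atTop, x ∉ Set.range (e i) := by
    obtain ⟨i₀, hi₀⟩ := hFell {(x : ℤ → 𝒜)} (Set.singleton_subset_iff.2 (hOX x.2))
      isCompact_singleton (Set.singleton_inter_eq_empty.2 (hOinf x x.2))
    filter_upwards [eventually_ge_atTop i₀] with i hi hx
    exact (hi₀ i hi).subset ⟨(he i x).1 hx, rfl⟩
  have hloc (x : O) : ∃ N : Set O, N.Finite ∧
      ∀ v : l2 O, (∀ y ∈ N, v y = 0) → H v x = 0 := by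
    obtain ⟨r, -, hr⟩ := hsupp
    refine ⟨Subtype.val ⁻¹' ((fun l : ℤ => tau (-l) (x : ℤ → 𝒜)) '' Set.Icc (-⌈r⌉) ⌈r⌉),
      ((Set.finite_Icc _ _).image _).preimage Subtype.val_injective.injOn, fun v hv => ?_⟩
    rw [hHdef, ← tsum_zero (β := {l : ℤ // tau (-l) (x : ℤ → 𝒜) ∈ O})]
    refine tsum_congr fun l => ?_
    by_cases hl : (|(l : ℤ)| : ℝ) > r
    · rw [hr _ _ hl, zero_mul]
    · rw [hv, mul_zero]
      refine ⟨l, ?_, rfl⟩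
      rw [Set.mem_Icc, ← abs_le]
      have : ((|(l : ℤ)| : ℤ) : ℝ) ≤ ⌈r⌉ := by
        push_cast
        exact (not_lt.1 hl).trans (Int.le_ceil r)
      exact_mod_cast this
  have hsymm : IsSelfAdjoint H := by
    classical
    have hentry (m n : ℤ) (hm : tau m z ∈ O) (hn : tau n z ∈ O) :
        H (lp.single 2 ⟨tau m z, hm⟩ 1) ⟨tau n z, hn⟩ = h (tau m z) (n - m) := by
      have hnm : tau (-(n - m)) (tau n z) = tau m z := by
        rw [tau_tau]
        congr 1
        ring
      rw [hHdef, tsum_eq_single ⟨n - m, hnm ▸ hm⟩]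
      · simp only [hnm, lp.single_apply_self, mul_one]
      · intro l hl
        rw [lp.single_apply_ne, mul_zero]
        intro heq
        refine hl (Subtype.ext ?_)
        have h1 := congrArg Subtype.val heq
        simp only [tau_tau] at h1
        have h2 : n + -(l : ℤ) = m := hinj h1
        change (l : ℤ) = n - m
        omega
    refine isSelfAdjoint_of_forall_single ?_
    rintro ⟨x, hx⟩ ⟨y, hy⟩
    obtain ⟨m, rfl⟩ := hO ▸ hx
    obtain ⟨n, rfl⟩ := hO ▸ hy
    rw [hentry, hentry, ← hsa _ (hOX hy), tau_tau]
    congr 1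
    · congr 1
      ring
    · ring
  have hcomp (i) (w : l2 ↥(M i \ Xinf)) (y : ↥(M i \ Xinf)) :
      HM i w y = H (extendByZero (e i) w) (e i y) := by
    classical
    rw [hHM, hHdef]
    let g (l : ℤ) : ℂ := if hl : tau (-l) (y : ℤ → 𝒜) ∈ M i \ Xinf then
      h (tau (-l) y) l * w ⟨tau (-l) y, hl⟩ else 0
    have hg : Function.support g ⊆ {l | tau (-l) (y : ℤ → 𝒜) ∈ M i \ Xinf} := by
      intro l hl
      by_contra hl'
      exact hl (dif_neg hl')
    have h1 := tsum_subtype_eq_of_support_subset hg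
    have h2 := tsum_subtype_eq_of_support_subset (hg.trans fun l hl => hMO i hl :
      Function.support g ⊆ {l | tau (-l) (y : ℤ → 𝒜) ∈ O})
    refine Eq.trans (tsum_congr fun l => ?_) (h1.trans (h2.symm.trans (tsum_congr fun l => ?_)))
    · simp only [g]
      rw [dif_pos l.2]
    · by_cases hl : tau (-(l : ℤ)) (y : ℤ → 𝒜) ∈ M i \ Xinf
      · refine (dif_pos hl).trans (congrArg _ ?_)
        exact (extendByZero_apply (e i) w ⟨_, hl⟩).symm
      · refine (dif_neg hl).trans ?_
        have hl' : (⟨tau (-(l : ℤ)) y, l.2⟩ : O) ∉ Set.range (e i) :=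
          fun hmem => hl ⟨(he i _).1 hmem, hOinf _ l.2⟩
        exact (mul_eq_zero_of_right _ (extendByZero_apply_of_notMem (e i) w hl')).symm
  exact ⟨(isLeast_essSpectrum e hfin hesc hsymm hloc hcomp).csInf_eq,
    (isGreatest_essSpectrum e hfin hesc hsymm hloc hcomp).csSup_eq⟩

end
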